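/- For every x ∈ (-1,1) with x ≠ x₀, the boundary values of D(z,w) := D(z,h)·D(z,w_{1,γ}) exist and satisfy lim_{z→x, Im z>0} D(z,w) = √(w(x))·exp(+i·Φ̂(x)) and lim_{z→x, Im z<0} D(z,w) = √(w(x))·exp(-i·Φ̂(x)), where w(x) = (1-x)^α (1+x)^β |x₀-x|^γ h(x), Φ(x) = πα/2 - ((α+β+γ)/2)·arccos x - (√(1-x²)/(2π))·PV∫_{-1}^1 (log h(t)/√(1-t²))·dt/(t-x), and Φ̂(x) = Φ(x) + πγ/2 for -1 < x < x₀ while Φ̂(x) = Φ(x) for x₀ < x < 1. -/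

import Mathlib

noncomputable section

open Filter Set MeasureTheory

/-- The segment `[-1,1]` viewed as a subset of `ℂ`. -/
def seg : Set ℂ := {z : ℂ | z.im = 0 ∧ -1 ≤ z.re ∧ z.re ≤ 1}

section BoundaryValues

open Topology Complex

/-- The open upper (`σ = 1`) or lower (`σ = -1`) half-plane. -/
def halfPlane (σ : ℝ) : Set ℂ := {z : ℂ | 0 < σ * z.im}

lemma halfPlane_subset_compl_seg (σ : ℝ) : halfPlane σ ⊆ segᶜ := by
  intro z hz hz'
  have hz : 0 < σ * z.im := hz
  rw [hz'.1] at hz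
  simp at hz

lemma isPreconnected_halfPlane (σ : ℝ) : IsPreconnected (halfPlane σ) := by
  refine Convex.isPreconnected fun z hz w hw a b ha hb hab => ?_
  simp only [halfPlane, mem_ofPred_eq, add_im, real_smul, im_ofReal_mul] at *
  rcases ha.eq_or_lt with rfl | ha
  · obtain rfl : b = 1 := by linarith
    simpa using hw
  · nlinarith [mul_pos ha hz, mul_nonneg hb hw.le]

lemma one_sub_sq_mem_slitPlane {σ : ℝ} {z : ℂ} (hz : z ∈ halfPlane σ) :
    1 - z ^ 2 ∈ slitPlane := by
  have him : z.im ≠ 0 := by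
    rintro h
    simp [halfPlane, h] at hz
  rw [mem_slitPlane_iff]
  have h2 : 0 < z.im ^ 2 := by positivity
  by_cases hre : z.re = 0
  · left
    simp [pow_two, hre]
    nlinarith
  · right
    have : z.re * z.im ≠ 0 := mul_ne_zero hre him
    simp [pow_two]
    intro h
    apply this
    linarith

lemma sqrt_branch_eqOn_halfPlane {s : ℂ → ℂ} {σ : ℝ} (hσ : σ = 1 ∨ σ = -1)
    (hs : DifferentiableOn ℂ s segᶜ) (hs2 : ∀ z ∉ seg, (s z) ^ 2 = z ^ 2 - 1)
    (hsinf : Tendsto (fun z => s z / z) (Bornology.cobounded ℂ) (𝓝 1)) :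
    EqOn s (fun z => σ * I * (1 - z ^ 2) ^ (2⁻¹ : ℂ)) (halfPlane σ) := by
  have hσ2 : (σ : ℂ) ^ 2 = 1 := by rcases hσ with rfl | rfl <;> simp
  have hσ0 : (σ : ℂ) ≠ 0 := by rcases hσ with rfl | rfl <;> simp
  have hq : ContinuousOn (fun z : ℂ => σ * I * (1 - z ^ 2) ^ (2⁻¹ : ℂ)) (halfPlane σ) := by
    refine continuousOn_const.mul (ContinuousOn.cpow_const (by fun_prop) fun z hz => ?_)
    exact one_sub_sq_mem_slitPlane hz
  have hsq : EqOn (s ^ 2) ((fun z : ℂ => σ * I * (1 - z ^ 2) ^ (2⁻¹ : ℂ)) ^ 2) (halfPlane σ) := by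
    intro z hz
    have hc : ((1 - z ^ 2) ^ (2⁻¹ : ℂ)) ^ 2 = 1 - z ^ 2 := cpow_nat_inv_pow _ two_ne_zero
    simp only [Pi.pow_apply]
    rw [hs2 z (halfPlane_subset_compl_seg σ hz), mul_pow, mul_pow, hσ2, I_sq, hc]
    ring
  have hne : ∀ {z : ℂ}, z ∈ halfPlane σ → σ * I * (1 - z ^ 2) ^ (2⁻¹ : ℂ) ≠ 0 := by
    intro z hz
    have := slitPlane_ne_zero (one_sub_sq_mem_slitPlane hz)
    simp [hσ0, cpow_eq_zero_iff, this]
  rcases (isPreconnected_halfPlane σ).eq_or_eq_neg_of_sq_eq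
    (hs.continuousOn.mono (halfPlane_subset_compl_seg σ)) hq hsq hne with h | h
  · exact h
  · exfalso
    have hlim : Tendsto (fun R : ℝ => (s (σ * I * R) / (σ * I * R)).re) atTop (𝓝 (1 : ℂ).re) := by
      refine (continuous_re.tendsto _).comp (hsinf.comp ?_)
      rw [← tendsto_norm_atTop_iff_cobounded]
      have : ∀ R : ℝ, ‖(σ * I * R : ℂ)‖ = |R| := by
        intro R
        rcases hσ with rfl | rfl <;> simp
      simp only [this]
      exact tendsto_abs_atTop_atTop
    have hle : (1 : ℂ).re ≤ 0 := by
      refine le_of_tendsto hlim ?_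
      filter_upwards [eventually_gt_atTop 0] with R hR
      have hmem : (σ * I * R : ℂ) ∈ halfPlane σ := by
        rcases hσ with rfl | rfl <;> simp [halfPlane, hR]
      have hval : (1 - (σ * I * R : ℂ) ^ 2) ^ (2⁻¹ : ℂ) = (((1 + R ^ 2) ^ (2⁻¹ : ℝ) : ℝ) : ℂ) := by
        rw [ofReal_cpow (by positivity)]
        push_cast
        rw [mul_pow, mul_pow, hσ2, I_sq]
        ring_nf
      have hR0 : (R : ℂ) ≠ 0 := by exact_mod_cast hR.ne'
      rw [h hmem]
      simp only [Pi.neg_apply, hval]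
      have : -(σ * I * (((1 + R ^ 2) ^ (2⁻¹ : ℝ) : ℝ) : ℂ)) / (σ * I * R)
          = ((-((1 + R ^ 2) ^ (2⁻¹ : ℝ) / R) : ℝ) : ℂ) := by
        push_cast
        field_simp
      rw [this, ofReal_re]
      have : 0 ≤ (1 + R ^ 2) ^ (2⁻¹ : ℝ) / R := by positivity
      linarith
    norm_num at hle

lemma tendsto_sqrt_branch {s : ℂ → ℂ} {σ : ℝ} (hσ : σ = 1 ∨ σ = -1)
    (hs : DifferentiableOn ℂ s segᶜ) (hs2 : ∀ z ∉ seg, (s z) ^ 2 = z ^ 2 - 1)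
    (hsinf : Tendsto (fun z => s z / z) (Bornology.cobounded ℂ) (𝓝 1))
    {x : ℝ} (hx : x ∈ Ioo (-1 : ℝ) 1) :
    Tendsto s (𝓝[halfPlane σ] (x : ℂ)) (𝓝 (σ * I * (√(1 - x ^ 2) : ℝ))) := by
  have hpos : 0 < 1 - x ^ 2 := by nlinarith [hx.1, hx.2]
  have hval : (1 - (x : ℂ) ^ 2) ^ (2⁻¹ : ℂ) = ((√(1 - x ^ 2) : ℝ) : ℂ) := by
    rw [Real.sqrt_eq_rpow, ofReal_cpow hpos.le]
    push_cast
    norm_num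
  have hcont : ContinuousAt (fun z : ℂ => σ * I * (1 - z ^ 2) ^ (2⁻¹ : ℂ)) x := by
    refine continuousAt_const.mul (ContinuousAt.cpow (by fun_prop) (by fun_prop) ?_)
    have : (1 - (x : ℂ) ^ 2) = ((1 - x ^ 2 : ℝ) : ℂ) := by push_cast; ring
    rw [this]
    exact ofReal_mem_slitPlane.2 hpos
  have := hcont.tendsto
  rw [hval] at this
  refine (this.mono_left nhdsWithin_le_nhds).congr' ?_
  filter_upwards [self_mem_nhdsWithin] with z hz
  exact (sqrt_branch_eqOn_halfPlane hσ hs hs2 hsinf hz).symm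

/-- The boundary value at a nonzero real point `y` of the principal logarithm, taken from the
half-plane `halfPlane σ`. -/
lemma tendsto_log_halfPlane {σ : ℝ} (hσ : σ = 1 ∨ σ = -1) {y : ℝ} (hy : y ≠ 0) :
    Tendsto log (𝓝[halfPlane σ] (y : ℂ))
      (𝓝 ((Real.log |y| : ℝ) + if y < 0 then (σ * Real.pi * I : ℂ) else 0)) := by
  split_ifs with h
  · rcases hσ with rfl | rfl
    · have := (continuousWithinAt_log_of_re_neg_of_im_zero (z := y) (by simpa) (by simp)).mono
        (show halfPlane 1 ⊆ {z : ℂ | 0 ≤ z.im} from fun z hz => by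
          have hz : 0 < 1 * z.im := hz
          show 0 ≤ z.im
          linarith)
      have h2 : log (y : ℂ) = (Real.log |y| : ℝ) + ((1 : ℝ) * Real.pi * I : ℂ) := by
        rw [log, arg_ofReal_of_neg h]
        simp
      rw [← h2]
      exact this
    · have := tendsto_log_nhdsWithin_im_neg_of_re_neg_of_im_zero (z := y) (by simpa) (by simp)
      convert this using 2
      · ext z; simp [halfPlane]
      · simp [sub_eq_add_neg]
  · have hy' : 0 < y := lt_of_le_of_ne (not_lt.1 h) hy.symm
    rw [add_zero, abs_of_pos hy', ofReal_log hy'.le]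
    exact (continuousAt_clog (ofReal_mem_slitPlane.2 hy')).tendsto.mono_left nhdsWithin_le_nhds

/-- A version of `tendsto_log_halfPlane` for the translate `z - c`. -/
lemma tendsto_log_sub_halfPlane {σ : ℝ} (hσ : σ = 1 ∨ σ = -1) {x c : ℝ} (hxc : x ≠ c) :
    Tendsto (fun z : ℂ => log (z - c)) (𝓝[halfPlane σ] (x : ℂ))
      (𝓝 ((Real.log |x - c| : ℝ) + if x < c then (σ * Real.pi * I : ℂ) else 0)) := by
  have h := tendsto_log_halfPlane hσ (sub_ne_zero.2 hxc)
  simp only [sub_neg] at h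
  refine h.comp (tendsto_nhdsWithin_iff.2 ⟨?_, ?_⟩)
  · push_cast
    exact ((continuous_id.sub continuous_const).tendsto (x : ℂ)).mono_left nhdsWithin_le_nhds
  · filter_upwards [self_mem_nhdsWithin] with z hz
    simpa [halfPlane] using hz

/-- The boundary value of the logarithm of the conformal map of the exterior of `[-1,1]`. -/
lemma tendsto_log_conformal_map {s : ℂ → ℂ} {σ : ℝ} (hσ : σ = 1 ∨ σ = -1) {x : ℝ}
    (hx : x ∈ Ioo (-1 : ℝ) 1)
    (hs : Tendsto s (𝓝[halfPlane σ] (x : ℂ)) (𝓝 (σ * I * (√(1 - x ^ 2) : ℝ)))) :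
    Tendsto (fun z => log (z + s z)) (𝓝[halfPlane σ] (x : ℂ)) (𝓝 (σ * I * Real.arccos x)) := by
  have hpos : 0 < √(1 - x ^ 2) := Real.sqrt_pos.2 (by nlinarith [hx.1, hx.2])
  have hexp : (x : ℂ) + σ * I * (√(1 - x ^ 2) : ℝ) = exp (σ * I * Real.arccos x) := by
    have hc : Real.cos (Real.arccos x) = x := Real.cos_arccos hx.1.le hx.2.le
    have hsn := Real.sin_arccos x
    rcases hσ with rfl | rfl
    · rw [show ((1 : ℝ) * I * Real.arccos x : ℂ) = Real.arccos x * I by push_cast; ring, exp_mul_I,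
        ← ofReal_cos, ← ofReal_sin, hc, hsn]
      push_cast; ring
    · rw [show ((-1 : ℝ) * I * Real.arccos x : ℂ) = (-Real.arccos x : ℝ) * I by push_cast; ring,
        exp_mul_I, ← ofReal_cos, ← ofReal_sin, Real.cos_neg, Real.sin_neg, hc, hsn]
      push_cast; ring
  have hlog : log (exp (σ * I * Real.arccos x)) = σ * I * Real.arccos x := by
    have h0 := Real.arccos_nonneg x
    have h1 := Real.arccos_lt_pi.2 hx.1
    apply log_exp <;> rcases hσ with rfl | rfl <;> simp <;> linarith [Real.pi_pos]
  have hsl : (x : ℂ) + σ * I * (√(1 - x ^ 2) : ℝ) ∈ slitPlane := by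
    rw [mem_slitPlane_iff]
    right
    rcases hσ with rfl | rfl <;> simp <;> exact hpos.ne'
  have hid : Tendsto (fun z : ℂ => z) (𝓝[halfPlane σ] (x : ℂ)) (𝓝 x) :=
    tendsto_id.mono_left nhdsWithin_le_nhds
  have := (hid.add hs).clog hsl
  rwa [hexp, hlog] at this

lemma exists_integrable_lipschitz_bound {f : ℝ → ℝ} {a b x : ℝ}
    (hf : IntervalIntegrable f volume a b) (hL : ∃ K, ∃ S ∈ 𝓝 x, LipschitzOnWith K f S) :
    ∃ G : ℝ → ℝ, IntervalIntegrable G volume a b ∧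
      ∀ᶠ u in 𝓝 x, ∀ t, |f t - f u| ≤ G t * |t - u| := by
  obtain ⟨K, S, hS, hL⟩ := hL
  obtain ⟨ε, hε, hεS⟩ := Metric.mem_nhds_iff.1 hS
  have hcont : ContinuousAt f x := hL.continuousOn.continuousAt hS
  have hM : ∀ᶠ u in 𝓝 x, |f u| < |f x| + 1 :=
    hcont.abs.eventually (gt_mem_nhds (lt_add_one _))
  refine ⟨fun t => K + (|f t| + (|f x| + 1)) * (ε / 2)⁻¹, ?_, ?_⟩
  · exact intervalIntegrable_const.add
      ((hf.abs.add intervalIntegrable_const).mul_const _)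
  · filter_upwards [hM, Metric.ball_mem_nhds x (half_pos hε)] with u hu hux t
    rw [Metric.mem_ball, Real.dist_eq] at hux
    have hn : 0 ≤ (|f t| + (|f x| + 1)) * (ε / 2)⁻¹ := by positivity
    by_cases ht : |t - x| < ε
    · have h1 := hL.dist_le_mul t (hεS (by rwa [Metric.mem_ball, Real.dist_eq])) u
        (hεS (by rw [Metric.mem_ball, Real.dist_eq]; linarith))
      rw [Real.dist_eq, Real.dist_eq] at h1
      exact h1.trans (mul_le_mul_of_nonneg_right (le_add_of_nonneg_right hn) (abs_nonneg _))
    · have h2 : ε / 2 ≤ |t - u| := by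
        have := abs_sub_le t u x
        linarith
      have h3 : 1 ≤ (ε / 2)⁻¹ * |t - u| := by
        rw [inv_mul_eq_div, one_le_div (half_pos hε)]
        exact h2
      have h4 : |f t - f u| ≤ |f t| + (|f x| + 1) := by
        have := abs_sub (f t) (f u)
        linarith
      have h5 : 0 ≤ (K : ℝ) * |t - u| := by positivity
      have h6 : 0 ≤ |f t| + (|f x| + 1) := by positivity
      nlinarith [mul_le_mul_of_nonneg_left h3 h6]

lemma intervalIntegrable_difference_quotient {f : ℝ → ℝ} {a b x : ℝ}
    (hf : IntervalIntegrable f volume a b) (hL : ∃ K, ∃ S ∈ 𝓝 x, LipschitzOnWith K f S) :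
    IntervalIntegrable (fun t => (f t - f x) / (t - x)) volume a b := by
  obtain ⟨G, hG, hGb⟩ := exists_integrable_lipschitz_bound hf hL
  have hx := hGb.self_of_nhds
  refine (hG.abs).mono_fun ?_ (Eventually.of_forall fun t => ?_)
  · have h1 := hf.aestronglyMeasurable_restrict_uIoc.sub (aestronglyMeasurable_const (b := f x))
    have h2 : Measurable fun t : ℝ => (t - x)⁻¹ := by fun_prop
    simp only [div_eq_mul_inv]
    exact h1.mul h2.aestronglyMeasurable
  · simp only [Real.norm_eq_abs, abs_abs]
    rw [abs_div]
    exact div_le_of_le_mul₀ (abs_nonneg _) (abs_nonneg _)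
      ((hx t).trans (mul_le_mul_of_nonneg_right (le_abs_self _) (abs_nonneg _)))

/-- The Cauchy principal value of `f(t)/(t-x)` over `[a,b]`, regularised by subtracting `f x`. -/
def cauchyPV (f : ℝ → ℝ) (a b x : ℝ) : ℝ :=
  f x * Real.log ((b - x) / (x - a)) + ∫ t in a..b, (f t - f x) / (t - x)

lemma integral_div_sub_eq {f : ℝ → ℝ} {c d x : ℝ} (hx : x ∉ uIcc c d)
    (hq : IntervalIntegrable (fun t => (f t - f x) / (t - x)) volume c d) :
    ∫ t in c..d, f t / (t - x) =
      f x * Real.log ((d - x) / (c - x)) + ∫ t in c..d, (f t - f x) / (t - x) := by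
  have hne : ∀ t ∈ uIcc c d, t - x ≠ 0 := fun t ht => sub_ne_zero.2 fun h => hx (h ▸ ht)
  have h0 : (0 : ℝ) ∉ uIcc (c - x) (d - x) := by
    rw [← image_sub_const_uIcc]
    rintro ⟨t, ht, h⟩
    exact hne t ht h
  have hi : IntervalIntegrable (fun t : ℝ => f x * (t - x)⁻¹) volume c d := by
    apply ContinuousOn.intervalIntegrable
    exact continuousOn_const.mul (ContinuousOn.inv₀ (by fun_prop) hne)
  have hlog : ∫ t in c..d, (t - x)⁻¹ = Real.log ((d - x) / (c - x)) := by
    rw [intervalIntegral.integral_comp_sub_right (fun t => t⁻¹), integral_inv h0]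
  rw [← hlog, ← intervalIntegral.integral_const_mul, ← intervalIntegral.integral_add hi hq]
  refine intervalIntegral.integral_congr fun t ht => ?_
  have := hne t ht
  field_simp
  ring

lemma tendsto_cauchyPV {f : ℝ → ℝ} {a b x : ℝ} (hax : a < x) (hxb : x < b)
    (hf : IntervalIntegrable f volume a b) (hL : ∃ K, ∃ S ∈ 𝓝 x, LipschitzOnWith K f S) :
    Tendsto (fun ε : ℝ => (∫ t in a..(x - ε), f t / (t - x)) + ∫ t in (x + ε)..b, f t / (t - x))
      (𝓝[>] 0) (𝓝 (cauchyPV f a b x)) := by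
  set g : ℝ → ℝ := fun t => (f t - f x) / (t - x) with hg
  have hgi : IntervalIntegrable g volume a b := intervalIntegrable_difference_quotient hf hL
  have hab : a ≤ b := (hax.trans hxb).le
  have hx : x ∈ uIcc a b := by rw [uIcc_of_le hab]; exact ⟨hax.le, hxb.le⟩
  have hsub : ∀ {c d}, c ∈ uIcc a b → d ∈ uIcc a b → IntervalIntegrable g volume c d :=
    fun hc hd => hgi.mono_set (uIcc_subset_uIcc hc hd)
  have hprim : ContinuousAt (fun y => ∫ t in a..y, g t) x := by
    refine (intervalIntegral.continuousOn_primitive_interval' hgi left_mem_uIcc).continuousAt ?_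
    rw [uIcc_of_le hab]
    exact Icc_mem_nhds hax hxb
  have hlim : Tendsto (fun ε : ℝ => f x * Real.log ((b - x) / (x - a)) +
      ((∫ t in a..(x - ε), g t) + ((∫ t in a..b, g t) - ∫ t in a..(x + ε), g t)))
      (𝓝[>] 0) (𝓝 (cauchyPV f a b x)) := by
    have e1 : Tendsto (fun ε : ℝ => x - ε) (𝓝[>] 0) (𝓝 x) := by
      have : Tendsto (fun ε : ℝ => x - ε) (𝓝 0) (𝓝 (x - 0)) := by
        apply Continuous.tendsto; fun_prop
      rw [sub_zero] at this
      exact this.mono_left nhdsWithin_le_nhds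
    have e2 : Tendsto (fun ε : ℝ => x + ε) (𝓝[>] 0) (𝓝 x) := by
      have : Tendsto (fun ε : ℝ => x + ε) (𝓝 0) (𝓝 (x + 0)) := by
        apply Continuous.tendsto; fun_prop
      rw [add_zero] at this
      exact this.mono_left nhdsWithin_le_nhds
    have := (tendsto_const_nhds (x := f x * Real.log ((b - x) / (x - a)))).add
      ((hprim.tendsto.comp e1).add
        ((tendsto_const_nhds (x := ∫ t in a..b, g t)).sub (hprim.tendsto.comp e2)))
    simpa [cauchyPV, hg] using this
  refine hlim.congr' ?_
  filter_upwards [self_mem_nhdsWithin, mem_nhdsWithin_of_mem_nhds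
    (gt_mem_nhds (lt_min (sub_pos.2 hax) (sub_pos.2 hxb)))] with ε (hε : 0 < ε) hε2
  have h1 : ε < x - a := hε2.trans_le (min_le_left _ _)
  have h2 : ε < b - x := hε2.trans_le (min_le_right _ _)
  have m1 : x - ε ∈ uIcc a b := by rw [uIcc_of_le hab]; constructor <;> linarith
  have m2 : x + ε ∈ uIcc a b := by rw [uIcc_of_le hab]; constructor <;> linarith
  have n1 : x ∉ uIcc a (x - ε) := by
    rw [uIcc_of_le (by linarith)]; rintro ⟨_, h⟩; linarith
  have n2 : x ∉ uIcc (x + ε) b := by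
    rw [uIcc_of_le (by linarith)]; rintro ⟨h, _⟩; linarith
  rw [integral_div_sub_eq n1 (hsub left_mem_uIcc m1), integral_div_sub_eq n2 (hsub m2 right_mem_uIcc),
    ← intervalIntegral.integral_interval_sub_left hgi (hsub left_mem_uIcc m2)]
  have hlog : Real.log ((b - x) / (x - a)) =
      Real.log ((x - ε - x) / (a - x)) + Real.log ((b - x) / (x + ε - x)) := by
    rw [show (x - ε - x) / (a - x) = ε / (x - a) by
        rw [← neg_div_neg_eq]; congr 1 <;> ring, add_sub_cancel_left,
      Real.log_div (by linarith) (by linarith), Real.log_div (by linarith) (by linarith),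
      Real.log_div (by linarith) (by linarith)]
    ring
  rw [hlog]
  ring

lemma integral_inv_sub_complex {a b σ : ℝ} (hσ : σ ≠ 0) {z : ℂ} (hz : z ∈ halfPlane σ) :
    ∫ t in a..b, ((t : ℂ) - z)⁻¹ = log (σ * I * (b - z)) - log (σ * I * (a - z)) := by
  have hz' : 0 < σ * z.im := hz
  have hsl : ∀ t : ℝ, σ * I * ((t : ℂ) - z) ∈ slitPlane := by
    intro t
    rw [mem_slitPlane_iff]
    left
    simpa using hz'
  have hne : ∀ t : ℝ, (t : ℂ) - z ≠ 0 := fun t h => by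
    have := slitPlane_ne_zero (hsl t)
    simp [h] at this
  have hσ' : (σ : ℂ) ≠ 0 := by exact_mod_cast hσ
  refine intervalIntegral.integral_eq_sub_of_hasDerivAt
    (f := fun t : ℝ => log (σ * I * ((t : ℂ) - z))) (fun t _ => ?_) ?_
  · have h1 : HasDerivAt (fun t : ℝ => σ * I * ((t : ℂ) - z)) (σ * I * 1) t :=
      ((ofRealCLM.hasDerivAt (x := t)).sub_const z).const_mul _
    have h2 := h1.clog_real (hsl t)
    rwa [mul_one, div_mul_cancel_left₀ (mul_ne_zero hσ' I_ne_zero)] at h2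
  · apply Continuous.intervalIntegrable
    exact (by fun_prop : Continuous fun t : ℝ => (t : ℂ) - z).inv₀ hne

lemma tendsto_integral_inv_sub {a b x σ : ℝ} (hσ : σ = 1 ∨ σ = -1) (hax : a < x) (hxb : x < b) :
    Tendsto (fun z : ℂ => ∫ t in a..b, ((t : ℂ) - z)⁻¹) (𝓝[halfPlane σ] (x : ℂ))
      (𝓝 ((Real.log ((b - x) / (x - a)) : ℝ) + σ * Real.pi * I)) := by
  have hσ0 : σ ≠ 0 := by rcases hσ with rfl | rfl <;> norm_num
  have key : ∀ c : ℝ, c ≠ x → Tendsto (fun z : ℂ => log (σ * I * (c - z)))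
      (𝓝[halfPlane σ] (x : ℂ)) (𝓝 (log (σ * I * (c - x)))) := by
    intro c hc
    have : ContinuousAt (fun z : ℂ => log (σ * I * (c - z))) x := by
      refine ContinuousAt.clog (by fun_prop) ?_
      rw [mem_slitPlane_iff]
      right
      rcases hσ with rfl | rfl <;> simp <;> intro h <;> apply hc <;> linarith
    exact this.tendsto.mono_left nhdsWithin_le_nhds
  have hb : log (σ * I * (b - x)) = (Real.log (b - x) : ℝ) + σ * (Real.pi / 2) * I := by
    rw [show σ * I * ((b : ℂ) - x) = ((b - x : ℝ) : ℂ) * (σ * I) by push_cast; ring,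
      log_ofReal_mul (sub_pos.2 hxb)]
    · rcases hσ with rfl | rfl <;> simp [log_I, log_neg_I]
    · rcases hσ with rfl | rfl <;> simp
  have ha : log (σ * I * (a - x)) = (Real.log (x - a) : ℝ) - σ * (Real.pi / 2) * I := by
    rw [show σ * I * ((a : ℂ) - x) = ((x - a : ℝ) : ℂ) * (-(σ * I)) by push_cast; ring,
      log_ofReal_mul (sub_pos.2 hax)]
    · rcases hσ with rfl | rfl <;> simp [log_I, log_neg_I, sub_eq_add_neg]
    · rcases hσ with rfl | rfl <;> simp
  have h := (key b hxb.ne').sub (key a hax.ne)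
  rw [hb, ha] at h
  rw [Real.log_div (by linarith) (by linarith)]
  convert h.congr' ?_ using 2
  · push_cast
    ring
  · filter_upwards [self_mem_nhdsWithin] with z hz
    exact (integral_inv_sub_complex hσ0 hz).symm

/-- The Sokhotski–Plemelj formula on an interval, for unrestricted approach to `x` from a
half-plane. -/
theorem tendsto_cauchy_integral_halfPlane {f : ℝ → ℝ} {a b x σ : ℝ} (hσ : σ = 1 ∨ σ = -1)
    (hax : a < x) (hxb : x < b) (hf : IntervalIntegrable f volume a b)
    (hL : ∃ K, ∃ S ∈ 𝓝 x, LipschitzOnWith K f S) :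
    Tendsto (fun z : ℂ => ∫ t in a..b, (f t : ℂ) / ((t : ℂ) - z)) (𝓝[halfPlane σ] (x : ℂ))
      (𝓝 (cauchyPV f a b x + σ * Real.pi * I * f x)) := by
  have hcont : ContinuousAt f x := by
    obtain ⟨K, S, hS, hL⟩ := hL
    exact hL.continuousOn.continuousAt hS
  obtain ⟨G, hG, hGb⟩ := exists_integrable_lipschitz_bound hf hL
  have hid : Tendsto (fun z : ℂ => z) (𝓝[halfPlane σ] (x : ℂ)) (𝓝 x) :=
    tendsto_id.mono_left nhdsWithin_le_nhds
  have hre : Tendsto (fun z : ℂ => z.re) (𝓝[halfPlane σ] (x : ℂ)) (𝓝 x) := by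
    exact (continuous_re.tendsto (x : ℂ)).comp hid
  have hfre : Tendsto (fun z : ℂ => f z.re) (𝓝[halfPlane σ] (x : ℂ)) (𝓝 (f x)) :=
    hcont.tendsto.comp hre
  have hne : ∀ z ∈ halfPlane σ, ∀ t : ℝ, (t : ℂ) - z ≠ 0 := by
    intro z hz t h
    have hz' : 0 < σ * z.im := hz
    rw [← sub_eq_zero.1 h] at hz'
    simp at hz'
  have hdct : Tendsto (fun z : ℂ => ∫ t in a..b, ((f t - f z.re : ℝ) : ℂ) / ((t : ℂ) - z))
      (𝓝[halfPlane σ] (x : ℂ))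
      (𝓝 (∫ t in a..b, ((f t - f x : ℝ) : ℂ) / ((t : ℂ) - x))) := by
    refine intervalIntegral.tendsto_integral_filter_of_dominated_convergence (fun t => |G t|)
      ?_ ?_ hG.abs ?_
    · refine Eventually.of_forall fun z => ?_
      have h1 := hf.aestronglyMeasurable_restrict_uIoc.sub (aestronglyMeasurable_const (b := f z.re))
      have h2 : Measurable fun t : ℝ => ((t : ℂ) - z)⁻¹ := by fun_prop
      have h3 := (continuous_ofReal.comp_aestronglyMeasurable h1).mul h2.aestronglyMeasurable
      simp only [div_eq_mul_inv]
      exact h3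
    · filter_upwards [hre.eventually hGb] with z hz
      refine Eventually.of_forall fun t _ => ?_
      rw [norm_div, norm_real, Real.norm_eq_abs]
      have h1 : |t - z.re| ≤ ‖(t : ℂ) - z‖ := by
        simpa using abs_re_le_norm ((t : ℂ) - z)
      refine div_le_of_le_mul₀ (norm_nonneg _) (abs_nonneg _) ((hz t).trans ?_)
      exact mul_le_mul (le_abs_self _) h1 (abs_nonneg _) (abs_nonneg _)
    · have : ∀ᵐ t : ℝ, t ≠ x := by simp [ae_iff]
      filter_upwards [this] with t ht _
      refine Tendsto.div ?_ (tendsto_const_nhds.sub hid) ?_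
      · exact (continuous_ofReal.tendsto _).comp (tendsto_const_nhds.sub hfre)
      · rw [sub_ne_zero]
        exact_mod_cast ht
  have hsum := hdct.add (((continuous_ofReal.tendsto _).comp hfre).mul
    (tendsto_integral_inv_sub hσ hax hxb))
  have hreal : ∫ t in a..b, ((f t - f x : ℝ) : ℂ) / ((t : ℂ) - x)
      = ((∫ t in a..b, (f t - f x) / (t - x) : ℝ) : ℂ) := by
    rw [← intervalIntegral.integral_ofReal]
    push_cast
    rfl
  rw [hreal] at hsum
  convert hsum.congr' ?_ using 2
  · simp only [cauchyPV]
    push_cast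
    ring
  · filter_upwards [self_mem_nhdsWithin] with z hz
    have hci : Continuous fun t : ℝ => ((t : ℂ) - z)⁻¹ :=
      (by fun_prop : Continuous fun t : ℝ => (t : ℂ) - z).inv₀ (hne z hz)
    have hfi : IntervalIntegrable (fun t => ((f t - f z.re : ℝ) : ℂ)) volume a b :=
      have h := hf.sub (intervalIntegrable_const (c := f z.re))
      ⟨h.1.ofReal, h.2.ofReal⟩
    have i1 := hfi.mul_continuousOn hci.continuousOn
    simp only [Function.comp_apply, div_eq_mul_inv]
    rw [← intervalIntegral.integral_const_mul, ← intervalIntegral.integral_add i1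
      ((hci.intervalIntegrable a b).const_mul _)]
    refine intervalIntegral.integral_congr fun t _ => ?_
    push_cast
    ring

lemma intervalIntegrable_inv_sqrt_one_sub_sq :
    IntervalIntegrable (fun t : ℝ => 1 / √(1 - t ^ 2)) volume (-1) 1 := by
  refine intervalIntegral.intervalIntegrable_deriv_of_nonneg
    Real.continuous_arcsin.continuousOn (fun t ht => ?_) (fun t _ => by positivity)
  rw [min_eq_left (by norm_num), max_eq_right (by norm_num)] at ht
  exact Real.hasDerivAt_arcsin ht.1.ne' ht.2.ne

section LogWeight

variable {h : ℂ → ℂ} {U : Set ℂ}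

lemma contDiffAt_log_re (hU : IsOpen U) (hseg : seg ⊆ U) (hhol : DifferentiableOn ℂ h U)
    (hpos : ∀ x ∈ Icc (-1 : ℝ) 1, (h x).im = 0 ∧ 0 < (h x).re) {x : ℝ} (hx : x ∈ Icc (-1 : ℝ) 1) :
    ContDiffAt ℝ 1 (fun t : ℝ => Real.log (h t).re) x := by
  have hxU : (x : ℂ) ∈ U := hseg (by simpa [seg] using hx)
  have h1 : ContDiffAt ℂ 1 h x := (hhol.analyticAt (hU.mem_nhds hxU)).contDiffAt
  exact h1.real_of_complex.log (hpos x hx).2.ne'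

lemma intervalIntegrable_log_div_sqrt (hU : IsOpen U) (hseg : seg ⊆ U)
    (hhol : DifferentiableOn ℂ h U)
    (hpos : ∀ x ∈ Icc (-1 : ℝ) 1, (h x).im = 0 ∧ 0 < (h x).re) :
    IntervalIntegrable (fun t : ℝ => Real.log (h t).re / √(1 - t ^ 2)) volume (-1) 1 := by
  have hc : ContinuousOn (fun t : ℝ => Real.log (h t).re) (uIcc (-1) 1) := by
    rw [uIcc_of_le (by norm_num)]
    exact fun t ht => (contDiffAt_log_re hU hseg hhol hpos ht).continuousAt.continuousWithinAt
  have := intervalIntegrable_inv_sqrt_one_sub_sq.continuousOn_mul hc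
  simpa only [mul_one_div] using this

lemma exists_lipschitzOnWith_log_div_sqrt (hU : IsOpen U) (hseg : seg ⊆ U)
    (hhol : DifferentiableOn ℂ h U)
    (hpos : ∀ x ∈ Icc (-1 : ℝ) 1, (h x).im = 0 ∧ 0 < (h x).re) {x : ℝ} (hx : x ∈ Ioo (-1 : ℝ) 1) :
    ∃ K, ∃ S ∈ 𝓝 x, LipschitzOnWith K (fun t : ℝ => Real.log (h t).re / √(1 - t ^ 2)) S := by
  have h0 : 0 < 1 - x ^ 2 := by nlinarith [hx.1, hx.2]
  have h1 : ContDiffAt ℝ 1 (fun t : ℝ => √(1 - t ^ 2)) x :=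
    ContDiffAt.sqrt (by fun_prop) h0.ne'
  exact ((contDiffAt_log_re hU hseg hhol hpos (Ioo_subset_Icc_self hx)).div h1
    (Real.sqrt_pos.2 h0).ne').exists_lipschitzOnWith

end LogWeight

/-- The boundary value of `(z-1)^a (z+1)^b (z-x₀)^c (z+s z)^d` on the cut `(-1,1)`. -/
lemma tendsto_jacobi_szego {s : ℂ → ℂ} {σ x x₀ : ℝ} (hσ : σ = 1 ∨ σ = -1)
    (hx : x ∈ Ioo (-1 : ℝ) 1) (hxx₀ : x ≠ x₀) (a b c d : ℝ)
    (hs : Tendsto s (𝓝[halfPlane σ] (x : ℂ)) (𝓝 (σ * I * (√(1 - x ^ 2) : ℝ)))) :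
    Tendsto (fun z => (z - 1) ^ (a : ℂ) * (z + 1) ^ (b : ℂ) * (z - (x₀ : ℂ)) ^ (c : ℂ) *
      (z + s z) ^ (d : ℂ)) (𝓝[halfPlane σ] (x : ℂ))
      (𝓝 (exp ((a * Real.log (1 - x) + b * Real.log (1 + x) + c * Real.log |x₀ - x| : ℝ) +
        σ * I * (Real.pi * a + d * Real.arccos x +
          if x < x₀ then Real.pi * c else 0 : ℝ)))) := by
  have h1 := tendsto_log_sub_halfPlane hσ (x := x) (c := 1) hx.2.ne
  have h2 := tendsto_log_sub_halfPlane hσ (x := x) (c := -1) hx.1.ne'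
  have h3 := tendsto_log_sub_halfPlane hσ hxx₀
  have h4 := tendsto_log_conformal_map hσ hx hs
  rw [if_pos hx.2, abs_sub_comm, abs_of_pos (sub_pos.2 hx.2)] at h1
  rw [if_neg (not_lt.2 hx.1.le), sub_neg_eq_add, add_comm x 1,
    abs_of_pos (by linarith [hx.1])] at h2
  rw [abs_sub_comm] at h3
  have hsum := ((((h1.mul_const (a : ℂ)).add (h2.mul_const (b : ℂ))).add
    (h3.mul_const (c : ℂ))).add (h4.mul_const (d : ℂ))).cexp
  have hne : ∀ᶠ z in 𝓝[halfPlane σ] (x : ℂ), z + s z ≠ 0 := by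
    refine Tendsto.eventually_ne ((tendsto_id.mono_left nhdsWithin_le_nhds).add hs) ?_
    have : 0 < √(1 - x ^ 2) := Real.sqrt_pos.2 (by nlinarith [hx.1, hx.2])
    intro h
    have := congrArg im h
    rcases hσ with rfl | rfl <;> simp at this <;> linarith
  convert hsum.congr' ?_ using 2
  · congr 1
    split_ifs <;> push_cast <;> ring
  · filter_upwards [hne, self_mem_nhdsWithin] with z hz hzσ
    have hre : ∀ y : ℝ, z - y ≠ 0 := by
      intro y h
      have hz' : 0 < σ * z.im := hzσ
      rw [sub_eq_zero.1 h] at hz'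
      simp at hz'
    have n1 : z - 1 ≠ 0 := by simpa using hre 1
    have n2 : z + 1 ≠ 0 := by simpa using hre (-1)
    rw [cpow_def_of_ne_zero n1, cpow_def_of_ne_zero n2, cpow_def_of_ne_zero (hre x₀),
      cpow_def_of_ne_zero hz, exp_add, exp_add, exp_add]
    push_cast
    rw [sub_neg_eq_add]

lemma sqrt_weight_eq_exp {x x₀ : ℝ} (hx : x ∈ Ioo (-1 : ℝ) 1) (hxx₀ : x ≠ x₀) (α β γ : ℝ) {H : ℝ}
    (hH : 0 < H) :
    √((1 - x) ^ α * (1 + x) ^ β * |x₀ - x| ^ γ * H) =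
      Real.exp (α / 2 * Real.log (1 - x) + β / 2 * Real.log (1 + x) +
        γ / 2 * Real.log |x₀ - x| + Real.log H / 2) := by
  have h1 : 0 < 1 - x := sub_pos.2 hx.2
  have h2 : 0 < 1 + x := by linarith [hx.1]
  have h3 : 0 < |x₀ - x| := abs_pos.2 (sub_ne_zero.2 hxx₀.symm)
  rw [Real.rpow_def_of_pos h1, Real.rpow_def_of_pos h2, Real.rpow_def_of_pos h3]
  conv_lhs => rw [← Real.exp_log hH]
  rw [← Real.exp_add, ← Real.exp_add, ← Real.exp_add, ← Real.exp_half]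
  congr 1
  ring

end BoundaryValues

open Topology Complex in
theorem szego_function_boundary_values_w
    (x₀ α β γ : ℝ) (hx₀ : x₀ ∈ Set.Ioo (-1 : ℝ) 1)
    (hα : -1 < α) (hβ : -1 < β) (hγ : -1 < γ)
    -- `h` is holomorphic in an open neighborhood of `[-1,1]` and strictly positive on `[-1,1]`
    (h : ℂ → ℂ) (U : Set ℂ) (hU : IsOpen U) (hseg : seg ⊆ U)
    (hhol : DifferentiableOn ℂ h U)
    (hpos : ∀ x ∈ Set.Icc (-1 : ℝ) 1, (h x).im = 0 ∧ 0 < (h x).re)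
    -- the branch of `√(z²-1)` holomorphic in `ℂ∖[-1,1]` with `√(z²-1)/z → 1` at `∞`
    (s : ℂ → ℂ)
    (hs : DifferentiableOn ℂ s segᶜ)
    (hs2 : ∀ z ∉ seg, (s z) ^ 2 = z ^ 2 - 1)
    (hsinf : Filter.Tendsto (fun z => s z / z) (Bornology.cobounded ℂ) (nhds 1))
    -- the Szegő function of `h`, built with `√(1-z²) = -i√(z²-1)`
    (Dh : ℂ → ℂ)
    (hDh : ∀ z ∉ seg, Dh z = Complex.exp ((-Complex.I * s z) *
        ((1 / (2 * (Real.pi : ℂ) * Complex.I)) * ∫ t in (-1 : ℝ)..1,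
          ((Real.log (h t).re / Real.sqrt (1 - t ^ 2) : ℝ) : ℂ) / ((t : ℂ) - z)))) :
    -- the Szegő function of `w_{1,γ}` (principal branches, `φ(z) = z + √(z²-1)`)
    ∀ Dw1 : ℂ → ℂ,
    (∀ z ∉ seg, Dw1 z =
        (z - 1) ^ ((α / 2 : ℝ) : ℂ) * (z + 1) ^ ((β / 2 : ℝ) : ℂ) *
        (z - (x₀ : ℂ)) ^ ((γ / 2 : ℝ) : ℂ) *
        (z + s z) ^ ((-(α + β + γ) / 2 : ℝ) : ℂ)) →
    ∀ x ∈ Set.Ioo (-1 : ℝ) 1, x ≠ x₀ → ∃ V : ℝ,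
      -- `V` is the Cauchy principal value of `∫_{-1}^1 (log h(t)/√(1-t²)) dt/(t-x)`
      Filter.Tendsto (fun ε : ℝ =>
          (∫ t in (-1 : ℝ)..(x - ε), Real.log (h t).re / (Real.sqrt (1 - t ^ 2) * (t - x))) +
          ∫ t in (x + ε)..(1 : ℝ), Real.log (h t).re / (Real.sqrt (1 - t ^ 2) * (t - x)))
        (nhdsWithin 0 (Set.Ioi 0)) (nhds V) ∧
      -- boundary values of `D(z,w) = D(z,h)·D(z,w_{1,γ})` with phase `Φ̂`
      (let wx : ℝ := (1 - x) ^ α * (1 + x) ^ β * |x₀ - x| ^ γ * (h x).re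
       let Φ : ℝ := Real.pi * α / 2 - (α + β + γ) / 2 * Real.arccos x
          - Real.sqrt (1 - x ^ 2) / (2 * Real.pi) * V
       let Φhat : ℝ := if x < x₀ then Φ + Real.pi * γ / 2 else Φ
       Filter.Tendsto (fun z => Dh z * Dw1 z) (nhdsWithin (x : ℂ) {z : ℂ | 0 < z.im})
          (nhds ((Real.sqrt wx : ℂ) * Complex.exp (Complex.I * (Φhat : ℂ)))) ∧
       Filter.Tendsto (fun z => Dh z * Dw1 z) (nhdsWithin (x : ℂ) {z : ℂ | z.im < 0})
          (nhds ((Real.sqrt wx : ℂ) * Complex.exp (-Complex.I * (Φhat : ℂ))))) := by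
  intro Dw1 hDw1 x hx hxx₀
  set f : ℝ → ℝ := fun t => Real.log (h t).re / √(1 - t ^ 2) with hf
  have hfi : IntervalIntegrable f volume (-1) 1 :=
    intervalIntegrable_log_div_sqrt hU hseg hhol hpos
  have hL : ∃ K, ∃ S ∈ 𝓝 x, LipschitzOnWith K f S :=
    exists_lipschitzOnWith_log_div_sqrt hU hseg hhol hpos hx
  set V := cauchyPV f (-1) 1 x
  refine ⟨V, ?_, ?_⟩
  · simpa only [hf, div_div] using tendsto_cauchyPV hx.1 hx.2 hfi hL
  intro wx Φ Φhat
  have hsq : 0 < √(1 - x ^ 2) := Real.sqrt_pos.2 (by nlinarith [hx.1, hx.2])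
  have main : ∀ σ : ℝ, σ = 1 ∨ σ = -1 → Tendsto (fun z => Dh z * Dw1 z) (𝓝[halfPlane σ] (x : ℂ))
      (𝓝 ((√wx : ℂ) * exp (σ * I * (Φhat : ℂ)))) := by
    intro σ hσ
    have hσ2 : (σ : ℂ) ^ 2 = 1 := by rcases hσ with rfl | rfl <;> simp
    have hs' := tendsto_sqrt_branch hσ hs hs2 hsinf hx
    have hD := ((hs'.const_mul (-I)).mul
      ((tendsto_cauchy_integral_halfPlane hσ hx.1 hx.2 hfi hL).const_mul
        (1 / (2 * (Real.pi : ℂ) * I)))).cexp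
    have hJ := tendsto_jacobi_szego hσ hx hxx₀ (α / 2) (β / 2) (γ / 2) (-(α + β + γ) / 2) hs'
    have hlim := hD.mul hJ
    rw [← exp_add] at hlim
    convert hlim.congr' ?_ using 2
    · have hfx : Real.log (h x).re = √(1 - x ^ 2) * f x := by
        rw [hf]
        field_simp
      rw [sqrt_weight_eq_exp hx hxx₀ α β γ (hpos x (Ioo_subset_Icc_self hx)).2, ofReal_exp,
        ← exp_add, hfx]
      congr 1
      simp only [Φhat, Φ]
      change _ = -I * (σ * I * (√(1 - x ^ 2) : ℝ)) *
        (1 / (2 * (Real.pi : ℂ) * I) * (V + σ * Real.pi * I * f x)) + _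
      have hA : -I * (σ * I * (√(1 - x ^ 2) : ℝ)) *
          (1 / (2 * (Real.pi : ℂ) * I) * (V + σ * Real.pi * I * f x)) =
          (√(1 - x ^ 2) : ℝ) * f x / 2 - σ * I * ((√(1 - x ^ 2) : ℝ) / (2 * Real.pi) * V) := by
        field_simp
        linear_combination (√(1 - x ^ 2) : ℂ) *
          (-σ ^ 2 * Real.pi * f x * I_sq + Real.pi * f x * hσ2)
      rw [hA]
      split_ifs <;> push_cast <;> ring
    · filter_upwards [self_mem_nhdsWithin] with z hz
      have hz' : z ∉ seg := halfPlane_subset_compl_seg σ hz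
      rw [hDh z hz', hDw1 z hz']
  constructor
  · simpa [halfPlane] using main 1 (Or.inl rfl)
  · simpa [halfPlane] using main (-1) (Or.inr rfl)
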